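/- arXiv:1702.00063 — 5 statements merged into one kernel-verified Lean document; each statement's English description precedes it below -/
import Mathlib

section
/- Let p : S → ℝ satisfy: p s = 1 for every s ∈ T; p s ≥ 0 for every s ∈ S; and p s ≥ Σ_{s'∈S} P s s' · p s' for every s ∉ T. Then for every n ∈ ℕ and every s ∈ S, reach n s ≤ p s. In particular, if p s₀ ≤ λ for a state s₀ and a threshold λ ∈ ℝ, then reach n s₀ ≤ λ for all n, so any solution of the relaxed reachability constraints gives an upper bound on the probability of reaching T. -/
open Finset

/-- n-step reachability probabilities of a (sub)stochastic chain. -/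
noncomputable def reach {S : Type*} [Fintype S] [DecidableEq S]
    (P : S → S → ℝ) (T : Finset S) : ℕ → S → ℝ
  | 0, s => if s ∈ T then 1 else 0
  | n + 1, s => if s ∈ T then 1 else ∑ s' : S, P s s' * reach P T n s'

/-- Any solution of the relaxed reachability constraints upper-bounds the
n-step reachability probabilities; in particular a threshold on `p s₀`
bounds `reach n s₀` for all `n`. -/
theorem relaxed_constraints_upper_bound_reachability
    {S : Type*} [Fintype S] [DecidableEq S]
    (P : S → S → ℝ) (T : Finset S)
    (hPnn : ∀ s s' : S, 0 ≤ P s s')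
    (hPsub : ∀ s : S, ∑ s' : S, P s s' ≤ 1)
    (p : S → ℝ)
    (hpT : ∀ s ∈ T, p s = 1)
    (hpnn : ∀ s : S, 0 ≤ p s)
    (hpsup : ∀ s : S, s ∉ T → ∑ s' : S, P s s' * p s' ≤ p s) :
    (∀ (n : ℕ) (s : S), reach P T n s ≤ p s) ∧
      (∀ (s₀ : S) (lam : ℝ), p s₀ ≤ lam → ∀ n : ℕ, reach P T n s₀ ≤ lam) := by
  have bound (n : ℕ) : ∀ s : S, reach P T n s ≤ p s := by
    induction n with
    | zero =>
      intro s
      by_cases hs : s ∈ T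
      · simp [reach, hs, hpT s hs]
      · simpa [reach, hs] using hpnn s
    | succ n ih =>
      intro s
      by_cases hs : s ∈ T
      · simp [reach, hs, hpT s hs]
      · rw [reach, if_neg hs]
        exact (Finset.sum_le_sum fun s' _ =>
          mul_le_mul_of_nonneg_left (ih s') (hPnn s s')).trans (hpsup s hs)
  exact ⟨bound, fun s₀ _ h n => (bound n s₀).trans h⟩
end

section
/- Assume additionally that P is stochastic, i.e., Σ_{s'∈S} P s s' = 1 for every s ∈ S. Define p* : S → ℝ by p* s = ⨆_{n∈ℕ} reach n s (the supremum exists since the sequence is monotone and bounded by 1). Then 0 ≤ p* s ≤ 1 for all s, p* s = 1 for every s ∈ T, and p* s = Σ_{s'∈S} P s s' · p* s' for every s ∉ T; i.e., the limiting reachability probabilities satisfy the Bellman fixed-point equations encoded as equality constraints in the nonlinear program. -/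
open Finset

section Reach

variable {S : Type*} [Fintype S] [DecidableEq S] {P : S → S → ℝ} {T : Finset S}

theorem reach_of_mem {s : S} (hs : s ∈ T) (n : ℕ) : reach P T n s = 1 := by
  cases n <;> simp [reach, hs]

theorem reach_succ_of_notMem {s : S} (hs : s ∉ T) (n : ℕ) :
    reach P T (n + 1) s = ∑ s' : S, P s s' * reach P T n s' := by
  simp [reach, hs]

theorem reach_nonneg (hP : ∀ s s' : S, 0 ≤ P s s') (n : ℕ) (s : S) : 0 ≤ reach P T n s := by
  induction n generalizing s with
  | zero => rw [reach]; split_ifs <;> norm_num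
  | succ n ih =>
    rw [reach]
    split_ifs
    · exact zero_le_one
    · exact Finset.sum_nonneg fun s' _ => mul_nonneg (hP s s') (ih s')

theorem reach_le_one (hP : ∀ s s' : S, 0 ≤ P s s') (hP1 : ∀ s : S, ∑ s' : S, P s s' ≤ 1)
    (n : ℕ) (s : S) : reach P T n s ≤ 1 := by
  induction n generalizing s with
  | zero => rw [reach]; split_ifs <;> norm_num
  | succ n ih =>
    rw [reach]
    split_ifs
    · exact le_rfl
    · exact (Finset.sum_le_sum fun s' _ => mul_le_of_le_one_right (hP s s') (ih s')).trans (hP1 s)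

theorem monotone_reach (hP : ∀ s s' : S, 0 ≤ P s s') (s : S) :
    Monotone fun n => reach P T n s := by
  refine monotone_nat_of_le_succ fun n => ?_
  induction n generalizing s with
  | zero =>
    by_cases hs : s ∈ T
    · simp only [reach_of_mem hs, le_refl]
    · simpa [reach, hs] using reach_nonneg (T := T) hP 1 s
  | succ n ih =>
    by_cases hs : s ∈ T
    · simp only [reach_of_mem hs, le_refl]
    · simp only [reach_succ_of_notMem hs]
      exact Finset.sum_le_sum fun s' _ => mul_le_mul_of_nonneg_left (ih s') (hP s s')

theorem tendsto_reach_iSup (hP : ∀ s s' : S, 0 ≤ P s s')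
    (hP1 : ∀ s : S, ∑ s' : S, P s s' ≤ 1) (s : S) :
    Filter.Tendsto (fun n => reach P T n s) Filter.atTop (nhds (⨆ n : ℕ, reach P T n s)) :=
  tendsto_atTop_ciSup (monotone_reach hP s)
    ⟨1, Set.forall_mem_range.2 fun n => reach_le_one hP hP1 n s⟩

end Reach

/-- For a stochastic matrix, the limiting reachability probabilities
`p* s = ⨆ n, reach n s` lie in `[0,1]`, equal `1` on the target set, and
satisfy the Bellman fixed-point equations outside the target set. -/
theorem limit_reachability_satisfies_bellman
    {S : Type*} [Fintype S] [DecidableEq S]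
    (P : S → S → ℝ) (T : Finset S)
    (hPnn : ∀ s s' : S, 0 ≤ P s s')
    (hPstoch : ∀ s : S, ∑ s' : S, P s s' = 1) :
    (∀ s : S, 0 ≤ (⨆ n : ℕ, reach P T n s) ∧ (⨆ n : ℕ, reach P T n s) ≤ 1) ∧
      (∀ s ∈ T, (⨆ n : ℕ, reach P T n s) = 1) ∧
      (∀ s : S, s ∉ T →
        (⨆ n : ℕ, reach P T n s) = ∑ s' : S, P s s' * ⨆ n : ℕ, reach P T n s') := by
  have hP1 : ∀ s : S, ∑ s' : S, P s s' ≤ 1 := fun s => (hPstoch s).le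
  refine ⟨fun s => ⟨Real.iSup_nonneg fun n => reach_nonneg hPnn n s,
    ciSup_le fun n => reach_le_one hPnn hP1 n s⟩, fun s hs => ?_, fun s hs => ?_⟩
  · simp only [reach_of_mem hs, ciSup_const]
  · have h := (tendsto_reach_iSup (T := T) hPnn hP1 s).comp (Filter.tendsto_add_atTop_nat 1)
    simp only [Function.comp_def, reach_succ_of_notMem hs] at h
    exact tendsto_nhds_unique h <| tendsto_finsetSum _ fun s' _ =>
      (tendsto_reach_iSup hPnn hP1 s').const_mul (P s s')
end

section
/- Let σ : S → A → ℝ be any randomized memoryless scheduler and let reachσ : ℕ → S → ℝ be the n-step reachability probabilities of the Markov chain induced by σ, i.e., reachσ 0 s = 1 if s ∈ T and 0 otherwise, and reachσ (n+1) s = 1 if s ∈ T and reachσ (n+1) s = Σ_{s'∈S} (Σ_{α∈A} σ s α · P s α s') · reachσ n s' otherwise. If p : S → ℝ satisfies p s = 1 for s ∈ T, p s ≥ 0 for all s, and p s ≥ Σ_{s'∈S} P s α s' · p s' for every s ∉ T and every enabled action α ∈ Act s, then reachσ n s ≤ p s for every n ∈ ℕ, every s ∈ S, and every scheduler σ; i.e.,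 a vector that is superharmonic for all enabled actions bounds the reachability probability under every scheduler. -/
open Finset

/-- n-step reachability probabilities of the Markov chain induced on an MDP
by a randomized memoryless scheduler `σ`. -/
noncomputable def reachSigma {S A : Type*} [Fintype S] [Fintype A] [DecidableEq S]
    (P : S → A → S → ℝ) (T : Finset S) (σ : S → A → ℝ) : ℕ → S → ℝ
  | 0, s => if s ∈ T then 1 else 0
  | n + 1, s =>
      if s ∈ T then 1
      else ∑ s' : S, (∑ α : A, σ s α * P s α s') * reachSigma P T σ n s'

/-- A vector that is superharmonic for all enabled actions bounds the
reachability probability under every randomized memoryless scheduler. -/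
theorem superharmonic_bounds_reachability_all_schedulers
    {S A : Type*} [Fintype S] [Fintype A] [DecidableEq S]
    (Act : S → Finset A) (hAct : ∀ s : S, (Act s).Nonempty)
    (P : S → A → S → ℝ) (T : Finset S)
    (hPnn : ∀ (s : S) (α : A) (s' : S), 0 ≤ P s α s')
    (hPstoch : ∀ (s : S) (α : A), α ∈ Act s → ∑ s' : S, P s α s' = 1)
    (p : S → ℝ)
    (hpT : ∀ s ∈ T, p s = 1)
    (hpnn : ∀ s : S, 0 ≤ p s)
    (hpsup : ∀ (s : S), s ∉ T → ∀ α ∈ Act s, ∑ s' : S, P s α s' * p s' ≤ p s) :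
    ∀ (σ : S → A → ℝ),
      (∀ (s : S) (α : A), 0 ≤ σ s α) →
      (∀ (s : S) (α : A), α ∉ Act s → σ s α = 0) →
      (∀ s : S, ∑ α : A, σ s α = 1) →
      ∀ (n : ℕ) (s : S), reachSigma P T σ n s ≤ p s := by
  intro σ hσnn hσAct hσsum n
  induction n with
  | zero =>
    intro s
    by_cases hs : s ∈ T
    · simp [reachSigma, hs, hpT s hs]
    · simpa [reachSigma, hs] using hpnn s
  | succ n ih =>
    intro s
    by_cases hs : s ∈ T
    · simp [reachSigma, hs, hpT s hs]
    · simp only [reachSigma, hs, if_false]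
      calc ∑ s', (∑ α, σ s α * P s α s') * reachSigma P T σ n s'
          ≤ ∑ s', (∑ α, σ s α * P s α s') * p s' :=
            Finset.sum_le_sum fun s' _ => mul_le_mul_of_nonneg_left (ih s')
              (Finset.sum_nonneg fun α _ => mul_nonneg (hσnn s α) (hPnn s α s'))
        _ = ∑ α, σ s α * ∑ s', P s α s' * p s' := by
            simp only [Finset.sum_mul, Finset.mul_sum, mul_assoc]
            exact Finset.sum_comm
        _ ≤ ∑ α, σ s α * p s := by
            refine Finset.sum_le_sum fun α _ => ?_
            by_cases hα : α ∈ Act s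
            · exact mul_le_mul_of_nonneg_left (hpsup s hs α hα) (hσnn s α)
            · simp [hσAct s α hα]
        _ = p s := by rw [← Finset.sum_mul, hσsum, one_mul]
end

section
/- The monomial approximation globally underestimates the posynomial: let f(x) = Σ_{k=1}^K cₖ · ∏_{i=1}^n xᵢ^{a_{ik}} be a posynomial, u a point in the positive orthant, and f̂ its monomial approximation near u as defined in the context. Then for every x in the positive orthant, f̂(x) ≤ f(x), with equality at x = u. -/
open Finset Real

/-- A weighted geometric mean of monomials is the monomial with averaged exponents. -/
theorem prod_rpow_sum_mul {ι κ : Type*} [Fintype ι] [Fintype κ] (w : κ → ℝ) (A : κ → ι → ℝ)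
    (y : ι → ℝ) (hy : ∀ i, 0 < y i) :
    ∏ i, y i ^ (∑ k, w k * A k i) = ∏ k, (∏ i, y i ^ A k i) ^ w k := by
  have expand : ∀ k, (∏ i, y i ^ A k i) ^ w k = ∏ i, y i ^ (w k * A k i) := fun k => by
    rw [← Real.finsetProd_rpow _ _ fun i _ => (Real.rpow_pos_of_pos (hy i) _).le]
    exact Finset.prod_congr rfl fun i _ => by rw [mul_comm, Real.rpow_mul (hy i).le]
  simp_rw [expand]
  rw [Finset.prod_comm]
  exact Finset.prod_congr rfl fun i _ => Real.rpow_sum_of_pos (hy i) _ _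

/-- The monomial approximation globally underestimates the posynomial on the
positive orthant, with equality at the expansion point. -/
theorem monomial_approximation_underestimates
    {n K : ℕ} (cf : Fin K → ℝ) (hcf : ∀ k : Fin K, 0 < cf k)
    (A : Fin K → Fin n → ℝ)
    (u : Fin n → ℝ) (hu : ∀ i : Fin n, 0 < u i) :
    let f : (Fin n → ℝ) → ℝ := fun x => ∑ k : Fin K, cf k * ∏ i : Fin n, x i ^ A k i
    let θ : Fin K → ℝ := fun k => cf k * (∏ i : Fin n, u i ^ A k i) / f u
    let α : Fin n → ℝ := fun i => ∑ k : Fin K, θ k * A k i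
    let fhat : (Fin n → ℝ) → ℝ := fun x => f u * ∏ i : Fin n, (x i / u i) ^ α i
    (∀ x : Fin n → ℝ, (∀ i : Fin n, 0 < x i) → fhat x ≤ f x) ∧ fhat u = f u := by
  intro f θ α fhat
  have hmono : ∀ k, 0 < ∏ i, u i ^ A k i := fun k =>
    Finset.prod_pos fun i _ => Real.rpow_pos_of_pos (hu i) _
  have hterm : ∀ k, 0 < cf k * ∏ i, u i ^ A k i := fun k => mul_pos (hcf k) (hmono k)
  refine ⟨fun x hx => ?_, ?_⟩
  · rcases isEmpty_or_nonempty (Fin K) with hK | hK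
    · simp [fhat, f]
    have hfu : 0 < f u := Finset.sum_pos (fun k _ => hterm k) Finset.univ_nonempty
    have hratio : ∀ i, 0 < x i / u i := fun i => div_pos (hx i) (hu i)
    have hθ : ∑ k, θ k = 1 := by
      rw [← Finset.sum_div]
      exact div_self hfu.ne'
    calc fhat x = f u * ∏ k, (∏ i, (x i / u i) ^ A k i) ^ θ k := by
          rw [← prod_rpow_sum_mul θ A _ hratio]
      _ ≤ f u * ∑ k, θ k * ∏ i, (x i / u i) ^ A k i :=
          mul_le_mul_of_nonneg_left
            (Real.geom_mean_le_arith_mean_weighted _ _ _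
              (fun k _ => (div_pos (hterm k) hfu).le) hθ
              fun k _ => Finset.prod_nonneg fun i _ => (Real.rpow_pos_of_pos (hratio i) _).le)
            hfu.le
      _ = f x := by
          rw [Finset.mul_sum]
          refine Finset.sum_congr rfl fun k _ => ?_
          have hdiv : ∏ i, (x i / u i) ^ A k i = (∏ i, x i ^ A k i) / ∏ i, u i ^ A k i := by
            rw [← Finset.prod_div_distrib]
            exact Finset.prod_congr rfl fun i _ => Real.div_rpow (hx i).le (hu i).le _
          have hne := (hmono k).ne'
          have hfne := hfu.ne'
          simp only [θ, hdiv]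
          field_simp
  · simp [fhat, fun i => div_self (hu i).ne']
end

section
/- Let σ : S → A → ℝ be a randomized memoryless scheduler, let Pσ s s' = Σ_{α∈A} σ s α · P s α s' be the induced transition matrix, and let expCostσ : ℕ → S → ℝ be the n-step expected costs of the induced chain: expCostσ 0 s = 0, and expCostσ (n+1) s = 0 if s ∈ G, and expCostσ (n+1) s = Σ_{α∈A} σ s α · ( c s α + Σ_{s'∈S} P s α s' · expCostσ n s' ) otherwise. If k : S → ℝ satisfies k s = 0 for s ∈ G, k s ≥ 0 for all s, and k s ≥ c s α + Σ_{s'∈S} P s α s' · k s' for every s ∉ G and every enabled action α ∈ Act s, then expCostσ n s ≤ k s for every n ∈ ℕ, every s ∈ S, and every scheduler σ. -/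
open Finset

/-- n-step expected costs of the Markov chain induced on an MDP by a
randomized memoryless scheduler `σ`. -/
noncomputable def expCostSigma {S A : Type*} [Fintype S] [Fintype A] [DecidableEq S]
    (P : S → A → S → ℝ) (c : S → A → ℝ) (G : Finset S) (σ : S → A → ℝ) :
    ℕ → S → ℝ
  | 0, _ => 0
  | n + 1, s =>
      if s ∈ G then 0
      else ∑ α : A, σ s α * (c s α + ∑ s' : S, P s α s' * expCostSigma P c G σ n s')

/-- A vector satisfying the relaxed expected-cost constraints for all enabled
actions bounds the expected cost under every randomized memoryless
scheduler. -/
theorem cost_superharmonic_bounds_all_schedulers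
    {S A : Type*} [Fintype S] [Fintype A] [DecidableEq S]
    (Act : S → Finset A) (hAct : ∀ s : S, (Act s).Nonempty)
    (P : S → A → S → ℝ) (c : S → A → ℝ) (G : Finset S)
    (hPnn : ∀ (s : S) (α : A) (s' : S), 0 ≤ P s α s')
    (hPstoch : ∀ (s : S) (α : A), α ∈ Act s → ∑ s' : S, P s α s' = 1)
    (hcnn : ∀ (s : S) (α : A), 0 ≤ c s α)
    (k : S → ℝ)
    (hkG : ∀ s ∈ G, k s = 0)
    (hknn : ∀ s : S, 0 ≤ k s)
    (hksup : ∀ (s : S), s ∉ G →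
      ∀ α ∈ Act s, c s α + ∑ s' : S, P s α s' * k s' ≤ k s) :
    ∀ (σ : S → A → ℝ),
      (∀ (s : S) (α : A), 0 ≤ σ s α) →
      (∀ (s : S) (α : A), α ∉ Act s → σ s α = 0) →
      (∀ s : S, ∑ α : A, σ s α = 1) →
      ∀ (n : ℕ) (s : S), expCostSigma P c G σ n s ≤ k s := by
  intro σ hσ hσAct hσsum n
  induction n with
  | zero => simpa only [expCostSigma] using hknn
  | succ n ih =>
    intro s
    rw [expCostSigma]
    split_ifs with hs
    · exact hknn s
    · calc ∑ α : A, σ s α * (c s α + ∑ s' : S, P s α s' * expCostSigma P c G σ n s')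
          ≤ ∑ α : A, σ s α * k s := by
            refine sum_le_sum fun α _ => ?_
            by_cases hα : α ∈ Act s
            · refine mul_le_mul_of_nonneg_left (le_trans ?_ (hksup s hs α hα)) (hσ s α)
              gcongr with s'
              · exact hPnn s α s'
              · exact ih s'
            · simp [hσAct s α hα]
        _ = k s := by rw [← sum_mul, hσsum, one_mul]
end
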